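/- Let B be an m×n dual quaternion matrix. Then there exist unitary dual quaternion matrices V ∈ 𝔻ℚ^{m×m} and U ∈ 𝔻ℚ^{n×n} such that V* B U is an m×n matrix whose off-diagonal entries are all zero and whose diagonal entries μ_1 ≥ μ_2 ≥ … ≥ μ_{min(m,n)} are nonnegative dual numbers, ordered decreasingly in the total order on dual numbers; moreover there is an index t with 0 ≤ t ≤ min(m,n) such that μ_1, …, μ_t are positive and μ_{t+1} = … = μ_{min(m,n)} = 0, and within the positive ones those with positive standard part (appreciable) come first, followed by positive infinitesimal ones. -/

import Mathlib

open TrivSqZeroExt Matrix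

/-- The quaternions. -/
abbrev HQ := Quaternion ℝ

/-- The dual quaternions: `q = q_st + q_I ε` with `ε² = 0`, `ε` commuting with quaternions. -/
abbrev DQ := DualNumber HQ

/-- Conjugation of a dual quaternion: `q* = q_st* + q_I* ε`. -/
noncomputable instance : Star DQ :=
  ⟨fun q => inl (star (fst q)) + inr (star (snd q))⟩

/-- A dual quaternion is appreciable if its standard part is nonzero. -/
def DQ.Appreciable (q : DQ) : Prop := fst q ≠ 0

/-- A dual quaternion is a dual number if both parts are real. -/
def DQ.IsDualNum (q : DQ) : Prop := ∃ a b : ℝ, q = inl (a : HQ) + inr (b : HQ)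

/-- The total order on dual numbers: `p ≤ q` iff `p_st < q_st`, or `p_st = q_st` and `p_I ≤ q_I`. -/
def DQ.le (p q : DQ) : Prop :=
  (fst p).re < (fst q).re ∨ ((fst p).re = (fst q).re ∧ (snd p).re ≤ (snd q).re)

/-- The strict total order on dual numbers. -/
def DQ.lt (p q : DQ) : Prop :=
  (fst p).re < (fst q).re ∨ ((fst p).re = (fst q).re ∧ (snd p).re < (snd q).re)

section Curves

instance : StarModule ℝ HQ := ⟨fun s a => Quaternion.star_smul s a⟩

open scoped Matrix.Norms.Operator in
/-- One-parameter groups generated by skew-Hermitian matrices are unitary and differentiable at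
the origin. -/
theorem exp_smul_facts {n : ℕ} {X : Matrix (Fin n) (Fin n) HQ} (hX : Xᴴ = -X) :
    (∀ t : ℝ, (NormedSpace.exp (t • X))ᴴ * NormedSpace.exp (t • X) = 1) ∧
    ∀ i j, HasDerivAt (fun t : ℝ => NormedSpace.exp (t • X) i j) (X i j) 0 := by
  constructor
  · intro t
    let _ : NormedAlgebra ℚ (Matrix (Fin n) (Fin n) HQ) := NormedAlgebra.restrictScalars ℚ ℝ _
    rw [← Matrix.exp_conjTranspose, conjTranspose_smul, hX, star_trivial, smul_neg]
    have h := NormedSpace.exp_add_of_commute (Commute.refl (t • X)).neg_left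
    rw [neg_add_cancel, NormedSpace.exp_zero] at h
    exact h.symm
  · intro i j
    have h := hasDerivAt_exp_smul_const (𝕂 := ℝ) X (0 : ℝ)
    simp only [zero_smul, NormedSpace.exp_zero, one_mul] at h
    let L : Matrix (Fin n) (Fin n) HQ →ₗ[ℝ] HQ := Matrix.entryLinearMap ℝ HQ i j
    exact (LinearMap.toContinuousLinearMap L).hasFDerivAt.comp_hasDerivAt (0 : ℝ) h

open scoped Matrix.Norms.Operator in
theorem exp_intertwine {m n : ℕ} {X : Matrix (Fin m) (Fin m) HQ} {Y : Matrix (Fin n) (Fin n) HQ}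
    {S : Matrix (Fin m) (Fin n) HQ} (h : S * Y = X * S) (t : ℝ) :
    S * NormedSpace.exp (t • Y) = NormedSpace.exp (t • X) * S := by
  have hk (k : ℕ) : S * (t • Y) ^ k = (t • X) ^ k * S := by
    induction k with
    | zero => simp
    | succ k ih =>
      rw [pow_succ, ← Matrix.mul_assoc, ih, Matrix.mul_assoc, Matrix.mul_smul, h,
        ← Matrix.smul_mul, ← Matrix.mul_assoc, ← pow_succ]
  have h1 := NormedSpace.exp_series_hasSum_exp' (𝕂 := ℝ) (t • Y)
  have h2 := NormedSpace.exp_series_hasSum_exp' (𝕂 := ℝ) (t • X)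
  have h3 := h1.map (AddMonoidHom.mk' (fun Z : Matrix (Fin n) (Fin n) HQ => S * Z)
    (fun a b => Matrix.mul_add S a b)) (by
      change Continuous fun Z : Matrix (Fin n) (Fin n) HQ => S * Z
      fun_prop)
  have h4 := h2.map (AddMonoidHom.mk' (fun Z : Matrix (Fin m) (Fin m) HQ => Z * S)
    (fun a b => Matrix.add_mul a b S)) (by
      change Continuous fun Z : Matrix (Fin m) (Fin m) HQ => Z * S
      fun_prop)
  refine h3.unique ?_
  have hf : (fun k : ℕ => S * ((k.factorial : ℝ)⁻¹ • (t • Y) ^ k)) =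
      fun k : ℕ => ((k.factorial : ℝ)⁻¹ • (t • X) ^ k) * S := by
    funext k
    rw [Matrix.mul_smul, Matrix.smul_mul, hk]
  change HasSum (fun k : ℕ => S * ((k.factorial : ℝ)⁻¹ • (t • Y) ^ k)) _
  rw [hf]
  exact h4

/-- The matrix-valued curve `A` has derivative `A'` at the origin, entry by entry. -/
def HasEntryDeriv {m n : ℕ} (A : ℝ → Matrix (Fin m) (Fin n) HQ) (A' : Matrix (Fin m) (Fin n) HQ) :
    Prop :=
  ∀ i j, HasDerivAt (fun t => A t i j) (A' i j) 0

theorem HasEntryDeriv.mul {l m n : ℕ} {A : ℝ → Matrix (Fin l) (Fin m) HQ}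
    {A' : Matrix (Fin l) (Fin m) HQ} {B : ℝ → Matrix (Fin m) (Fin n) HQ}
    {B' : Matrix (Fin m) (Fin n) HQ} (hA : HasEntryDeriv A A') (hB : HasEntryDeriv B B') :
    HasEntryDeriv (fun t => A t * B t) (A' * B 0 + A 0 * B') := by
  intro i j
  simp only [Matrix.mul_apply, Matrix.add_apply, ← Finset.sum_add_distrib]
  exact HasDerivAt.fun_sum fun k _ => (hA i k).mul (hB k j)

theorem HasEntryDeriv.conjTranspose {m n : ℕ} {A : ℝ → Matrix (Fin m) (Fin n) HQ}
    {A' : Matrix (Fin m) (Fin n) HQ} (hA : HasEntryDeriv A A') :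
    HasEntryDeriv (fun t => (A t)ᴴ) A'ᴴ :=
  fun i j => (hA j i).star

theorem hasEntryDeriv_const {m n : ℕ} (A : Matrix (Fin m) (Fin n) HQ) :
    HasEntryDeriv (fun _ => A) 0 :=
  fun i j => hasDerivAt_const 0 (A i j)

theorem HasEntryDeriv.re_trace {n : ℕ} {A : ℝ → Matrix (Fin n) (Fin n) HQ}
    {A' : Matrix (Fin n) (Fin n) HQ} (hA : HasEntryDeriv A A') :
    HasDerivAt (fun t => (A t).trace.re) A'.trace.re 0 := by
  have h : HasDerivAt (fun t => (A t).trace) A'.trace 0 :=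
    HasDerivAt.fun_sum fun k _ => hA k k
  let L : HQ →ₗ[ℝ] ℝ :=
    { toFun := fun q => q.re, map_add' := fun _ _ => rfl, map_smul' := fun _ _ => rfl }
  exact (LinearMap.toContinuousLinearMap L).hasFDerivAt.comp_hasDerivAt (0 : ℝ) h

/-- If a linear functional of `Gᴴ * D * H` is maximal at the identity along the one-parameter
groups generated by skew-Hermitian `X` and `Y`, its first variation vanishes. -/
theorem first_variation {m n : ℕ} {X : Matrix (Fin m) (Fin m) HQ} {Y : Matrix (Fin n) (Fin n) HQ}
    (hX : Xᴴ = -X) (hY : Yᴴ = -Y) (W : Matrix (Fin n) (Fin m) HQ) (D : Matrix (Fin m) (Fin n) HQ)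
    (hmax : ∀ t : ℝ, (W * ((NormedSpace.exp (t • X))ᴴ * D * NormedSpace.exp (t • Y))).trace.re ≤
      (W * D).trace.re) :
    (W * (D * Y - X * D)).trace.re = 0 := by
  have hP : HasEntryDeriv (fun t : ℝ => NormedSpace.exp (t • X)) X := (exp_smul_facts hX).2
  have hQ : HasEntryDeriv (fun t : ℝ => NormedSpace.exp (t • Y)) Y := (exp_smul_facts hY).2
  have hd := ((hasEntryDeriv_const W).mul
    ((hP.conjTranspose.mul (hasEntryDeriv_const D)).mul hQ)).re_trace
  simp only [zero_smul, NormedSpace.exp_zero, conjTranspose_one, Matrix.mul_one, Matrix.one_mul,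
    Matrix.zero_mul, zero_add, Matrix.mul_zero, add_zero, hX] at hd
  have hloc : IsLocalMax (fun t : ℝ =>
      (W * ((NormedSpace.exp (t • X))ᴴ * D * NormedSpace.exp (t • Y))).trace.re) 0 :=
    Filter.Eventually.of_forall fun t => by simpa using hmax t
  have := hloc.hasDerivAt_eq_zero hd
  rwa [Matrix.neg_mul, neg_add_eq_sub] at this

end Curves

section Maximizers

theorem re_sum {ι : Type*} (s : Finset ι) (f : ι → HQ) : (∑ i ∈ s, f i).re = ∑ i ∈ s, (f i).re :=
  map_sum (⟨⟨fun q => q.re, rfl⟩, fun _ _ => rfl⟩ : HQ →+ ℝ) f s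

/-- Square quaternion matrices with orthonormal columns. -/
def unitarySet (n : ℕ) : Set (Matrix (Fin n) (Fin n) HQ) := {P | Pᴴ * P = 1}

theorem mul_mem_unitarySet {n : ℕ} {P Q : Matrix (Fin n) (Fin n) HQ} (hP : P ∈ unitarySet n)
    (hQ : Q ∈ unitarySet n) : P * Q ∈ unitarySet n := by
  change (P * Q)ᴴ * (P * Q) = 1
  rw [conjTranspose_mul, Matrix.mul_assoc, ← Matrix.mul_assoc Pᴴ, show Pᴴ * P = 1 from hP,
    Matrix.one_mul]
  exact hQ

theorem one_mem_unitarySet (n : ℕ) : (1 : Matrix (Fin n) (Fin n) HQ) ∈ unitarySet n := by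
  simp [unitarySet]

theorem isCompact_unitarySet (n : ℕ) : IsCompact (unitarySet n) := by
  have : ProperSpace HQ := FiniteDimensional.proper ℝ HQ
  have hK : IsCompact {P : Matrix (Fin n) (Fin n) HQ | ∀ i, P i ∈
      {v : Fin n → HQ | ∀ j, v j ∈ Metric.closedBall (0 : HQ) 1}} :=
    isCompact_pi_infinite fun _ => isCompact_pi_infinite fun _ => isCompact_closedBall _ _
  refine hK.of_isClosed_subset ?_ ?_
  · have hc : Continuous fun P : Matrix (Fin n) (Fin n) HQ => Pᴴ * P :=
      continuous_id.matrix_conjTranspose.matrix_mul continuous_id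
    exact isClosed_eq hc continuous_const
  · intro P hP i j
    have h : (Pᴴ * P) j j = 1 := by rw [show Pᴴ * P = 1 from hP, one_apply_eq]
    have h2 : ∑ k, ‖P k j‖ * ‖P k j‖ = 1 := by
      rw [Matrix.mul_apply] at h
      simp only [conjTranspose_apply, Quaternion.star_mul_self,
        Quaternion.normSq_eq_norm_mul_self] at h
      have h' : (∑ k, ((‖P k j‖ * ‖P k j‖ : ℝ) : HQ)).re = (1 : HQ).re := by rw [h]
      rw [re_sum] at h'
      exact h'
    have h3 := Finset.single_le_sum (f := fun k => ‖P k j‖ * ‖P k j‖)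
      (fun k _ => mul_self_nonneg _) (Finset.mem_univ i)
    rw [h2] at h3
    rw [mem_closedBall_zero_iff]
    nlinarith [norm_nonneg (P i j)]

theorem IsCompact.exists_lex_max {X : Type*} [TopologicalSpace X] {K : Set X} (hK : IsCompact K)
    (hne : K.Nonempty) {f g : X → ℝ} (hf : Continuous f) (hg : Continuous g) :
    ∃ x ∈ K, ∀ y ∈ K, f y ≤ f x ∧ (f y = f x → g y ≤ g x) := by
  obtain ⟨p, hp, hpmax⟩ := hK.exists_isMaxOn hne hf.continuousOn
  have hK' := hK.inter_right (isClosed_eq hf (continuous_const (y := f p)))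
  obtain ⟨q, ⟨hq, hqp⟩, hqmax⟩ := hK'.exists_isMaxOn ⟨p, hp, rfl⟩ hg.continuousOn
  have hqp : f q = f p := hqp
  exact ⟨q, hq, fun y hy => ⟨hqp ▸ hpmax hy, fun h => hqmax ⟨hy, h.trans hqp⟩⟩⟩

/-- Lexicographic maximizers over pairs of unitary matrices of a real linear functional evaluated
first at `A`, then at `C`. -/
theorem exists_lex_maximizer {m n : ℕ} (W : Matrix (Fin n) (Fin m) HQ)
    (A C : Matrix (Fin m) (Fin n) HQ) :
    ∃ P ∈ unitarySet m, ∃ Q ∈ unitarySet n, ∀ G ∈ unitarySet m, ∀ H ∈ unitarySet n,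
      (W * (Gᴴ * (Pᴴ * A * Q) * H)).trace.re ≤ (W * (Pᴴ * A * Q)).trace.re ∧
      ((W * (Gᴴ * (Pᴴ * A * Q) * H)).trace.re = (W * (Pᴴ * A * Q)).trace.re →
        (W * (Gᴴ * (Pᴴ * C * Q) * H)).trace.re ≤ (W * (Pᴴ * C * Q)).trace.re) := by
  have hf (A : Matrix (Fin m) (Fin n) HQ) : Continuous
      (fun p : Matrix (Fin m) (Fin m) HQ × Matrix (Fin n) (Fin n) HQ =>
        (W * (p.1ᴴ * A * p.2)).trace.re) :=
    Quaternion.continuous_re.comp (continuous_const.matrix_mul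
      ((_root_.continuous_fst.matrix_conjTranspose.matrix_mul continuous_const).matrix_mul
        _root_.continuous_snd)).matrix_trace
  have hassoc (A : Matrix (Fin m) (Fin n) HQ) (P G : Matrix (Fin m) (Fin m) HQ)
      (Q H : Matrix (Fin n) (Fin n) HQ) :
      Gᴴ * (Pᴴ * A * Q) * H = (P * G)ᴴ * A * (Q * H) := by
    simp only [conjTranspose_mul, Matrix.mul_assoc]
  obtain ⟨⟨P, Q⟩, hPQ, hmax⟩ := ((isCompact_unitarySet m).prod
    (isCompact_unitarySet n)).exists_lex_max
    ⟨(1, 1), one_mem_unitarySet m, one_mem_unitarySet n⟩ (hf A) (hf C)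
  refine ⟨P, hPQ.1, Q, hPQ.2, fun G hG H hH => ?_⟩
  rw [hassoc, hassoc]
  exact hmax (P * G, Q * H) ⟨mul_mem_unitarySet hPQ.1 hG, mul_mem_unitarySet hPQ.2 hH⟩

end Maximizers

section Weights

/-- Strictly decreasing positive weights. -/
noncomputable def weight (k : ℕ) : ℝ := ((k : ℝ) + 1)⁻¹

theorem weight_pos (k : ℕ) : 0 < weight k := by unfold weight; positivity

theorem weight_lt {a b : ℕ} (h : a < b) : weight b < weight a := by
  unfold weight
  have : (a : ℝ) < b := by exact_mod_cast h
  gcongr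

/-- The rectangular diagonal matrix of weights. -/
noncomputable def weightMatrix (m n : ℕ) : Matrix (Fin n) (Fin m) HQ :=
  of fun j i => if (j : ℕ) = i then (weight j : HQ) else 0

/-- The entry of a matrix at arbitrary natural positions, extended by zero. -/
noncomputable def natEntry {m n : ℕ} (M : Matrix (Fin m) (Fin n) HQ) (i j : ℕ) : HQ :=
  if h : i < m ∧ j < n then M ⟨i, h.1⟩ ⟨j, h.2⟩ else 0

theorem natEntry_val {m n : ℕ} (M : Matrix (Fin m) (Fin n) HQ) (i : Fin m) (j : Fin n) :
    natEntry M i j = M i j := by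
  simp [natEntry]

theorem natEntry_eq_zero {m n : ℕ} (M : Matrix (Fin m) (Fin n) HQ) {i j : ℕ}
    (h : m ≤ i ∨ n ≤ j) : natEntry M i j = 0 := by
  rw [natEntry, dif_neg]
  omega

theorem weightMatrix_mul_apply {m n : ℕ} (M : Matrix (Fin m) (Fin n) HQ) (a b : Fin n) :
    (weightMatrix m n * M) a b = (weight a : HQ) * natEntry M a b := by
  rw [Matrix.mul_apply]
  by_cases h : (a : ℕ) < m
  · rw [Fintype.sum_eq_single (⟨a, h⟩ : Fin m)]
    · simp [weightMatrix, natEntry, h]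
    · intro x hx
      have : (a : ℕ) ≠ x := fun h' => hx (Fin.ext h'.symm)
      simp [weightMatrix, this]
  · rw [natEntry_eq_zero M (Or.inl (not_lt.1 h)), mul_zero]
    refine Finset.sum_eq_zero fun x _ => ?_
    have : (a : ℕ) ≠ x := by omega
    simp [weightMatrix, this]

theorem mul_weightMatrix_apply {m n : ℕ} (M : Matrix (Fin m) (Fin n) HQ) (a b : Fin m) :
    (M * weightMatrix m n) a b = (weight b : HQ) * natEntry M a b := by
  rw [Matrix.mul_apply]
  by_cases h : (b : ℕ) < n
  · rw [Fintype.sum_eq_single (⟨b, h⟩ : Fin n)]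
    · simpa [weightMatrix, natEntry, h] using (Quaternion.coe_commutes _ _).symm
    · intro x hx
      have : (x : ℕ) ≠ b := fun h' => hx (Fin.ext h')
      simp [weightMatrix, this]
  · rw [natEntry_eq_zero M (Or.inr (not_lt.1 h)), mul_zero]
    refine Finset.sum_eq_zero fun x _ => ?_
    have : (x : ℕ) ≠ b := by omega
    simp [weightMatrix, this]

theorem re_mul_comm (p q : HQ) : (p * q).re = (q * p).re := by
  simp only [Quaternion.re_mul]; ring

theorem re_trace_weightMatrix_mul {m n : ℕ} (M : Matrix (Fin m) (Fin n) HQ) :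
    (weightMatrix m n * M).trace.re = ∑ k : Fin n, weight k * (natEntry M k k).re := by
  simp [trace, re_sum, weightMatrix_mul_apply, Quaternion.re_mul]

theorem re_trace_mul_comm {m n : ℕ} (M : Matrix (Fin m) (Fin n) HQ)
    (N : Matrix (Fin n) (Fin m) HQ) : (M * N).trace.re = (N * M).trace.re := by
  simp only [trace, diag_apply, Matrix.mul_apply, re_sum]
  rw [Finset.sum_comm]
  simp only [re_mul_comm]

/-- Elementary skew-Hermitian matrices. -/
noncomputable def skewSingle {n : ℕ} (a b : Fin n) (q : HQ) : Matrix (Fin n) (Fin n) HQ :=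
  single a b q - single b a (star q)

theorem conjTranspose_skewSingle {n : ℕ} (a b : Fin n) (q : HQ) :
    (skewSingle a b q)ᴴ = -skewSingle a b q := by
  simp [skewSingle, conjTranspose_single]

theorem re_trace_mul_skewSingle {n : ℕ} (S : Matrix (Fin n) (Fin n) HQ) (a b : Fin n) (q : HQ) :
    (S * skewSingle a b q).trace.re = ((S b a - star (S a b)) * q).re := by
  rw [skewSingle, Matrix.mul_sub, trace_sub, trace_mul_single, trace_mul_single]
  simp [Quaternion.re_mul]
  ring

theorem eq_zero_of_re_mul {p : HQ} (h : ∀ q, (p * q).re = 0) : p = 0 := by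
  have := h (star p)
  rw [Quaternion.self_mul_star, Quaternion.re_coe] at this
  exact Quaternion.normSq_eq_zero.1 this

theorem coe_ne_zero {r : ℝ} (h : r ≠ 0) : (r : HQ) ≠ 0 := fun h' =>
  h (Quaternion.coe_injective (h'.trans Quaternion.coe_zero.symm))

theorem re_trace_weightMatrix_mul_sub {m n : ℕ} (D : Matrix (Fin m) (Fin n) HQ)
    (X : Matrix (Fin m) (Fin m) HQ) (Y : Matrix (Fin n) (Fin n) HQ) :
    (weightMatrix m n * (D * Y - X * D)).trace.re =
      (weightMatrix m n * D * Y).trace.re - (D * weightMatrix m n * X).trace.re := by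
  rw [Matrix.mul_sub, trace_sub, Quaternion.re_sub, ← Matrix.mul_assoc,
    re_trace_mul_comm _ (X * D), Matrix.mul_assoc X, re_trace_mul_comm X]

theorem right_stationary {m n : ℕ} {D : Matrix (Fin m) (Fin n) HQ} {a b : Fin n}
    (h : ∀ q, (weightMatrix m n * (D * skewSingle a b q -
      (0 : Matrix (Fin m) (Fin m) HQ) * D)).trace.re = 0) :
    (weight b : HQ) * natEntry D b a = weight a * star (natEntry D a b) := by
  have : (weightMatrix m n * D) b a - star ((weightMatrix m n * D) a b) = 0 :=
    eq_zero_of_re_mul fun q => by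
      have hq := h q
      rw [re_trace_weightMatrix_mul_sub, Matrix.mul_zero, trace_zero, Quaternion.re_zero, sub_zero,
        re_trace_mul_skewSingle] at hq
      exact hq
  rw [weightMatrix_mul_apply, weightMatrix_mul_apply, star_mul, Quaternion.star_coe,
    ← Quaternion.coe_commutes] at this
  exact sub_eq_zero.1 this

theorem left_stationary {m n : ℕ} {D : Matrix (Fin m) (Fin n) HQ} {a b : Fin m}
    (h : ∀ q, (weightMatrix m n * (D * (0 : Matrix (Fin n) (Fin n) HQ) -
      skewSingle a b q * D)).trace.re = 0) :
    (weight a : HQ) * natEntry D b a = weight b * star (natEntry D a b) := by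
  have : (D * weightMatrix m n) b a - star ((D * weightMatrix m n) a b) = 0 :=
    eq_zero_of_re_mul fun q => by
      have hq := h q
      rw [re_trace_weightMatrix_mul_sub, Matrix.mul_zero, trace_zero, Quaternion.re_zero, zero_sub,
        re_trace_mul_skewSingle] at hq
      exact neg_eq_zero.1 hq
  rw [mul_weightMatrix_apply, mul_weightMatrix_apply, star_mul, Quaternion.star_coe,
    ← Quaternion.coe_commutes] at this
  exact sub_eq_zero.1 this

theorem both_stationary {m n : ℕ} {D : Matrix (Fin m) (Fin n) HQ} {a b : Fin m} {a' b' : Fin n}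
    (ha : (a : ℕ) = a') (hb : (b : ℕ) = b') (hab : (a : ℕ) ≠ b)
    (h : ∀ q, (weightMatrix m n * (D * skewSingle a' b' q - skewSingle a b q * D)).trace.re = 0) :
    natEntry D b a = -star (natEntry D a b) := by
  have : ((weightMatrix m n * D) b' a' - star ((weightMatrix m n * D) a' b')) -
      ((D * weightMatrix m n) b a - star ((D * weightMatrix m n) a b)) = 0 :=
    eq_zero_of_re_mul fun q => by
      have hq := h q
      rw [re_trace_weightMatrix_mul_sub, re_trace_mul_skewSingle, re_trace_mul_skewSingle] at hq
      rw [sub_mul, Quaternion.re_sub]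
      exact hq
  simp only [weightMatrix_mul_apply, mul_weightMatrix_apply, star_mul, Quaternion.star_coe,
    ← Quaternion.coe_commutes, ← ha, ← hb] at this
  have hw : (((weight b - weight a : ℝ) : HQ)) ≠ 0 := by
    have : weight b - weight a ≠ 0 := by
      rcases lt_or_gt_of_ne hab with h | h
      · exact sub_ne_zero.2 (weight_lt h).ne
      · exact sub_ne_zero.2 (weight_lt h).ne'
    exact coe_ne_zero this
  rw [eq_neg_iff_add_eq_zero]
  refine (mul_eq_zero.1 ?_).resolve_left hw
  rw [← this, Quaternion.coe_sub]
  noncomm_ring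

theorem eq_coe_re_of_star_eq {p : HQ} (h : p = star p) : p = (p.re : HQ) := by
  exact (Quaternion.star_eq_self.1 h.symm)

/-- Two weighted symmetry relations force a pair of entries to vanish off the diagonal and to be
real on the diagonal. -/
theorem diagonal_of_stationary {m n : ℕ} {D : Matrix (Fin m) (Fin n) HQ} {p : ℕ → Prop}
    (hR : ∀ a < n, ∀ b < n, p a → p b →
      (weight b : HQ) * natEntry D b a = weight a * star (natEntry D a b))
    (hL : ∀ a < m, ∀ b < m, p a → p b →
      (weight a : HQ) * natEntry D b a = weight b * star (natEntry D a b))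
    {i j : ℕ} (hi : i < m) (hj : j < n) (hpi : p i) (hpj : p j) :
    natEntry D i j = if i = j then ((natEntry D i i).re : HQ) else 0 := by
  have hw (k : ℕ) : (weight k : HQ) ≠ 0 := coe_ne_zero (weight_pos k).ne'
  split_ifs with hij
  · subst hij
    exact eq_coe_re_of_star_eq (mul_left_cancel₀ (hw i) (hR i hj i hj hpi hpi))
  · by_cases hin : i < n
    · by_cases hjm : j < m
      · have h1 := hR j hj i hin hpj hpi
        have h2 := hL j hjm i hi hpj hpi
        set p := natEntry D i j
        set q := star (natEntry D j i)
        have h3 : ((weight i ^ 2 - weight j ^ 2 : ℝ) : HQ) * p = 0 := by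
          have h4 : (weight i : HQ) * (weight i * p) = weight j * (weight j * p) := by
            rw [h1, h2, ← mul_assoc, ← mul_assoc, Quaternion.coe_commutes]
          rw [Quaternion.coe_sub, Quaternion.coe_pow, Quaternion.coe_pow, sub_mul, sq, sq,
            mul_assoc, mul_assoc, h4, sub_self]
        refine (mul_eq_zero.1 h3).resolve_left ?_
        have : weight i ^ 2 - weight j ^ 2 ≠ 0 := by
          have hi := weight_pos i
          have hj := weight_pos j
          rcases lt_or_gt_of_ne hij with h | h <;> have := weight_lt h
          · nlinarith
          · nlinarith
        exact coe_ne_zero this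
      · have h1 := hR j hj i hin hpj hpi
        rw [natEntry_eq_zero D (i := j) (Or.inl (not_lt.1 hjm)), star_zero, mul_zero] at h1
        exact (mul_eq_zero.1 h1).resolve_left (hw i)
    · have h2 := hL j (by omega) i hi hpj hpi
      rw [natEntry_eq_zero D (i := j) (Or.inr (not_lt.1 hin)), star_zero, mul_zero] at h2
      exact (mul_eq_zero.1 h2).resolve_left (hw j)

end Weights

section NormalForm

theorem re_trace_sign_flip {m n : ℕ} (a : Fin m) (b : Fin n) (hab : (a : ℕ) = b) :
    ∃ G ∈ unitarySet m, ∀ M : Matrix (Fin m) (Fin n) HQ,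
      (weightMatrix m n * (Gᴴ * M * (1 : Matrix (Fin n) (Fin n) HQ))).trace.re =
        (weightMatrix m n * M).trace.re - 2 * weight a * (natEntry M a a).re := by
  let d : Fin m → HQ := fun i => if i = a then -1 else 1
  refine ⟨diagonal d, ?_, fun M => ?_⟩
  · change (diagonal d)ᴴ * diagonal d = 1
    rw [diagonal_conjTranspose, diagonal_mul_diagonal, ← diagonal_one]
    congr 1
    funext i
    by_cases h : i = a <;> simp [d, h]
  · rw [re_trace_weightMatrix_mul, re_trace_weightMatrix_mul, eq_comm, sub_eq_iff_eq_add,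
      ← sub_eq_iff_eq_add', ← Finset.sum_sub_distrib, Fintype.sum_eq_single b]
    · have : natEntry ((diagonal d)ᴴ * M * (1 : Matrix (Fin n) (Fin n) HQ)) b b = -natEntry M b b := by
        rw [natEntry, natEntry, dif_pos ⟨hab ▸ a.2, b.2⟩, dif_pos ⟨hab ▸ a.2, b.2⟩]
        simp [diagonal_conjTranspose, diagonal_mul, d, ← hab]
      rw [this, hab, Quaternion.re_neg]
      ring
    · intro k hk
      have : natEntry ((diagonal d)ᴴ * M * (1 : Matrix (Fin n) (Fin n) HQ)) k k = natEntry M k k := by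
        by_cases hkm : (k : ℕ) < m
        · have hka : (⟨k, hkm⟩ : Fin m) ≠ a := fun h => hk (Fin.ext (by
            rw [← hab, ← h]))
          rw [natEntry, natEntry, dif_pos ⟨hkm, k.2⟩, dif_pos ⟨hkm, k.2⟩]
          simp [diagonal_conjTranspose, diagonal_mul, d, hka]
        · rw [natEntry_eq_zero _ (Or.inl (not_lt.1 hkm)), natEntry_eq_zero _ (Or.inl (not_lt.1 hkm))]
      rw [this, sub_self]

theorem submatrix_one_mem_unitarySet {n : ℕ} (e : Equiv.Perm (Fin n)) :
    (1 : Matrix (Fin n) (Fin n) HQ).submatrix id e ∈ unitarySet n := by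
  change _ᴴ * _ = (1 : Matrix (Fin n) (Fin n) HQ)
  rw [conjTranspose_submatrix, conjTranspose_one, ← submatrix_mul _ _ _ _ _ Function.bijective_id,
    Matrix.mul_one, submatrix_one_equiv]

theorem re_trace_swap {m n : ℕ} {a b : ℕ} (hab : a ≠ b) (ham : a < m) (hbm : b < m) (han : a < n)
    (hbn : b < n) :
    ∃ G ∈ unitarySet m, ∃ H ∈ unitarySet n, ∀ M : Matrix (Fin m) (Fin n) HQ,
      (weightMatrix m n * (Gᴴ * M * H)).trace.re =
        (weightMatrix m n * M).trace.re -
          (weight a - weight b) * ((natEntry M a a).re - (natEntry M b b).re) := by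
  let e : Equiv.Perm (Fin m) := Equiv.swap ⟨a, ham⟩ ⟨b, hbm⟩
  let f : Equiv.Perm (Fin n) := Equiv.swap ⟨a, han⟩ ⟨b, hbn⟩
  refine ⟨_, submatrix_one_mem_unitarySet e, _, submatrix_one_mem_unitarySet f, fun M => ?_⟩
  have hM : ((1 : Matrix (Fin m) (Fin m) HQ).submatrix id e)ᴴ * M *
      (1 : Matrix (Fin n) (Fin n) HQ).submatrix id f = M.submatrix e f := by
    ext1 i j
    simp [Matrix.mul_apply, one_apply]
  rw [hM, re_trace_weightMatrix_mul, re_trace_weightMatrix_mul, eq_comm, sub_eq_iff_eq_add,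
    ← sub_eq_iff_eq_add', ← Finset.sum_sub_distrib,
    Fintype.sum_eq_add (⟨a, han⟩ : Fin n) ⟨b, hbn⟩ (by simpa using hab)]
  · have h1 : natEntry (M.submatrix e f) a a = natEntry M b b := by
      simp [natEntry, ham, han, hbm, hbn, e, f]
    have h2 : natEntry (M.submatrix e f) b b = natEntry M a a := by
      simp [natEntry, ham, han, hbm, hbn, e, f]
    simp only [h1, h2]
    ring
  · rintro k ⟨hka, hkb⟩
    have hka' : (k : ℕ) ≠ a := fun h => hka (Fin.ext h)
    have hkb' : (k : ℕ) ≠ b := fun h => hkb (Fin.ext h)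
    have : natEntry (M.submatrix e f) k k = natEntry M k k := by
      by_cases hkm : (k : ℕ) < m
      · rw [natEntry, natEntry, dif_pos ⟨hkm, k.2⟩, dif_pos ⟨hkm, k.2⟩, submatrix_apply]
        congr 1
        · exact Equiv.swap_apply_of_ne_of_ne (by simpa using hka') (by simpa using hkb')
        · exact Equiv.swap_apply_of_ne_of_ne hka hkb
      · rw [natEntry_eq_zero _ (Or.inl (not_lt.1 hkm)), natEntry_eq_zero _ (Or.inl (not_lt.1 hkm))]
    rw [this, sub_self]

theorem mul_skewSingle_eq_zero {m n : ℕ} {M : Matrix (Fin m) (Fin n) HQ} {a b : Fin n}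
    (ha : ∀ i, M i a = 0) (hb : ∀ i, M i b = 0) (q : HQ) : M * skewSingle a b q = 0 := by
  ext1 i j
  rw [Matrix.mul_apply]
  refine Finset.sum_eq_zero fun k _ => ?_
  by_cases hk : k = a
  · rw [hk, ha, zero_mul]
  by_cases hk' : k = b
  · rw [hk', hb, zero_mul]
  simp [skewSingle, single, Ne.symm hk, Ne.symm hk']

theorem skewSingle_mul_eq_zero {m n : ℕ} {M : Matrix (Fin m) (Fin n) HQ} {a b : Fin m}
    (ha : ∀ j, M a j = 0) (hb : ∀ j, M b j = 0) (q : HQ) : skewSingle a b q * M = 0 := by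
  ext1 i j
  rw [Matrix.mul_apply]
  refine Finset.sum_eq_zero fun k _ => ?_
  by_cases hk : k = a
  · rw [hk, ha, mul_zero]
  by_cases hk' : k = b
  · rw [hk', hb, mul_zero]
  simp [skewSingle, single, Ne.symm hk, Ne.symm hk']

theorem mul_single_comm_of_diagonal {m n : ℕ} {M : Matrix (Fin m) (Fin n) HQ} {a b : Fin m}
    {a' b' : Fin n} (s : ℝ) (ha : ∀ i, M i a' = if i = a then (s : HQ) else 0)
    (hb : ∀ j, M b j = if j = b' then (s : HQ) else 0) (q : HQ) :
    M * single a' b' q = single a b q * M := by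
  ext1 i j
  rw [Matrix.mul_apply, Matrix.mul_apply, Fintype.sum_eq_single a', Fintype.sum_eq_single b, ha, hb]
  · by_cases hi : i = a <;> by_cases hj : j = b' <;>
      simp [single, hi, hj, @eq_comm _ a i, @eq_comm _ b' j, Quaternion.coe_commutes]
  · intro k hk
    simp [single, Ne.symm hk]
  · intro k hk
    simp [single, Ne.symm hk]

/-- Simultaneous normal form for the standard part `A` and the infinitesimal part `C`: the first
becomes diagonal with singular values `σ`, the second is brought to a shape whose remaining
entries can be removed by infinitesimal unitaries. -/
theorem exists_normal_form {m n : ℕ} (A C : Matrix (Fin m) (Fin n) HQ) :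
    ∃ P ∈ unitarySet m, ∃ Q ∈ unitarySet n, ∃ σ δ : ℕ → ℝ,
      (∀ i j, natEntry (Pᴴ * A * Q) i j = if i = j then (σ i : HQ) else 0) ∧
      (∀ k, (natEntry (Pᴴ * C * Q) k k).re = δ k) ∧
      (∀ k, 0 ≤ σ k) ∧ (∀ k, σ k = 0 → 0 ≤ δ k) ∧
      (∀ a b, a < b → b < m → b < n → σ b ≤ σ a ∧ (σ a = σ b → δ b ≤ δ a)) ∧
      (∀ i < m, ∀ j < n, σ i = 0 → σ j = 0 →
        natEntry (Pᴴ * C * Q) i j = if i = j then (δ i : HQ) else 0) ∧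
      (∀ a b, a ≠ b → σ a = σ b → σ a ≠ 0 →
        natEntry (Pᴴ * C * Q) b a = -star (natEntry (Pᴴ * C * Q) a b)) := by
  obtain ⟨P, hP, Q, hQ, hmax⟩ := exists_lex_maximizer (weightMatrix m n) A C
  refine ⟨P, hP, Q, hQ, ?_⟩
  generalize Pᴴ * A * Q = M at hmax ⊢
  generalize Pᴴ * C * Q = D at hmax ⊢
  have varM {X : Matrix (Fin m) (Fin m) HQ} {Y : Matrix (Fin n) (Fin n) HQ} (hX : Xᴴ = -X)
      (hY : Yᴴ = -Y) : (weightMatrix m n * (M * Y - X * M)).trace.re = 0 :=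
    first_variation hX hY _ _ fun t =>
      (hmax _ ((exp_smul_facts hX).1 t) _ ((exp_smul_facts hY).1 t)).1
  have varD {X : Matrix (Fin m) (Fin m) HQ} {Y : Matrix (Fin n) (Fin n) HQ} (hX : Xᴴ = -X)
      (hY : Yᴴ = -Y) (h : M * Y = X * M) : (weightMatrix m n * (D * Y - X * D)).trace.re = 0 :=
    first_variation hX hY _ _ fun t =>
      (hmax _ ((exp_smul_facts hX).1 t) _ ((exp_smul_facts hY).1 t)).2 (by
        rw [Matrix.mul_assoc _ M, exp_intertwine h, ← Matrix.mul_assoc _ _ M,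
          (exp_smul_facts hX).1 t, Matrix.one_mul])
  have hM (i j : ℕ) : natEntry M i j = if i = j then ((natEntry M i i).re : HQ) else 0 := by
    by_cases hij : i < m ∧ j < n
    · refine diagonal_of_stationary (p := fun _ => True) (fun a ha b hb _ _ => ?_)
        (fun a ha b hb _ _ => ?_) hij.1 hij.2 trivial trivial
      · exact right_stationary (a := ⟨a, ha⟩) (b := ⟨b, hb⟩) fun q =>
          varM (by simp) (conjTranspose_skewSingle _ _ _)
      · exact left_stationary (a := ⟨a, ha⟩) (b := ⟨b, hb⟩) fun q =>
          varM (conjTranspose_skewSingle _ _ _) (by simp)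
    · have h : m ≤ i ∨ n ≤ j := by omega
      rw [natEntry_eq_zero M h]
      split_ifs with hij
      · subst hij
        rw [natEntry_eq_zero M h]
        rfl
      · rfl
  refine ⟨fun k => (natEntry M k k).re, fun k => (natEntry D k k).re, hM, fun k => rfl,
    ?_, ?_, ?_, ?_, ?_⟩
  · intro k
    by_cases hk : k < m ∧ k < n
    · obtain ⟨G, hG, h⟩ := re_trace_sign_flip (⟨k, hk.1⟩ : Fin m) (⟨k, hk.2⟩ : Fin n) rfl
      have := (hmax G hG 1 (one_mem_unitarySet n)).1
      rw [h M] at this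
      have hw := weight_pos k
      change 0 ≤ (natEntry M k k).re
      by_contra! hneg
      have := mul_neg_of_pos_of_neg hw hneg
      simp only at *
      linarith
    · simp only
      rw [natEntry_eq_zero M (by omega)]
      exact le_rfl
  · intro k hk0
    by_cases hk : k < m ∧ k < n
    · obtain ⟨G, hG, h⟩ := re_trace_sign_flip (⟨k, hk.1⟩ : Fin m) (⟨k, hk.2⟩ : Fin n) rfl
      have := (hmax G hG 1 (one_mem_unitarySet n)).2 (by
        simp only at hk0
        rw [h M, hk0, mul_zero, sub_zero])
      rw [h D] at this
      have hw := weight_pos k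
      change 0 ≤ (natEntry D k k).re
      by_contra! hneg
      have := mul_neg_of_pos_of_neg hw hneg
      simp only at *
      linarith
    · simp only
      rw [natEntry_eq_zero D (by omega)]
      exact le_rfl
  · intro a b hab hbm hbn
    obtain ⟨G, hG, H, hH, h⟩ := re_trace_swap hab.ne (hab.trans hbm) hbm (hab.trans hbn) hbn
    have hw := sub_pos.2 (weight_lt hab)
    obtain ⟨h1, h2⟩ := hmax G hG H hH
    rw [h M] at h1 h2
    rw [h D] at h2
    constructor
    · have := nonneg_of_mul_nonneg_right (sub_le_self_iff _ |>.1 h1) hw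
      exact sub_nonneg.1 this
    · intro hs
      have := h2 (by simp only at hs; rw [hs, sub_self, mul_zero, sub_zero])
      exact sub_nonneg.1 (nonneg_of_mul_nonneg_right (sub_le_self_iff _ |>.1 this) hw)
  · intro i hi j hj hsi hsj
    refine diagonal_of_stationary (p := fun k => (natEntry M k k).re = 0)
      (fun a ha b hb hsa hsb => ?_) (fun a ha b hb hsa hsb => ?_) hi hj hsi hsj
    · have hcol (c : ℕ) (hc : c < n) (hs : (natEntry M c c).re = 0) (i : Fin m) :
          M i ⟨c, hc⟩ = 0 := by
        rw [← natEntry_val M, hM]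
        split_ifs with h
        · rw [h, hs, Quaternion.coe_zero]
        · rfl
      exact right_stationary (a := ⟨a, ha⟩) (b := ⟨b, hb⟩) fun q =>
        varD (by simp) (conjTranspose_skewSingle _ _ _) (by
          rw [mul_skewSingle_eq_zero (hcol a ha hsa) (hcol b hb hsb), Matrix.zero_mul])
    · have hrow (c : ℕ) (hc : c < m) (hs : (natEntry M c c).re = 0) (j : Fin n) :
          M ⟨c, hc⟩ j = 0 := by
        rw [← natEntry_val M, hM]
        split_ifs with h
        · rw [hs, Quaternion.coe_zero]
        · rfl
      exact left_stationary (a := ⟨a, ha⟩) (b := ⟨b, hb⟩) fun q =>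
        varD (conjTranspose_skewSingle _ _ _) (by simp) (by
          rw [skewSingle_mul_eq_zero (hrow a ha hsa) (hrow b hb hsb), Matrix.mul_zero])
  · intro a b hab hs hs0
    have hlt (c : ℕ) (hc : (natEntry M c c).re ≠ 0) : c < m ∧ c < n := by
      by_contra hcc
      rw [natEntry_eq_zero M (by omega)] at hc
      exact hc rfl
    obtain ⟨ham, han⟩ := hlt a hs0
    obtain ⟨hbm, hbn⟩ := hlt b fun h => hs0 (hs.trans h)
    have hcol (c : ℕ) (hcm : c < m) (hcn : c < n) (i : Fin m) :
        M i ⟨c, hcn⟩ = if i = ⟨c, hcm⟩ then ((natEntry M c c).re : HQ) else 0 := by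
      rw [← natEntry_val M, hM]
      by_cases h : (i : ℕ) = c <;> simp [h, Fin.ext_iff]
    have hrow (c : ℕ) (hcm : c < m) (hcn : c < n) (j : Fin n) :
        M ⟨c, hcm⟩ j = if j = ⟨c, hcn⟩ then ((natEntry M c c).re : HQ) else 0 := by
      rw [← natEntry_val M, hM]
      by_cases h : (j : ℕ) = c
      · simp [h, Fin.ext_iff]
      · simp [h, Ne.symm h, Fin.ext_iff]
    have hs' : (natEntry M a a).re = (natEntry M b b).re := hs
    refine both_stationary (a := ⟨a, ham⟩) (b := ⟨b, hbm⟩) (a' := ⟨a, han⟩) (b' := ⟨b, hbn⟩)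
      rfl rfl hab fun q => varD (conjTranspose_skewSingle _ _ _) (conjTranspose_skewSingle _ _ _) ?_
    rw [skewSingle, skewSingle, Matrix.mul_sub, Matrix.sub_mul,
      mul_single_comm_of_diagonal _ (hcol a ham han) (fun j => hs' ▸ hrow b hbm hbn j),
      mul_single_comm_of_diagonal _ (hcol b hbm hbn) (fun j => hs' ▸ hrow a ham han j)]

end NormalForm

section DualMatrix

/-- The dual quaternion matrix with given standard and infinitesimal parts. -/
noncomputable def dualMatrix {m n : ℕ} (A C : Matrix (Fin m) (Fin n) HQ) :
    Matrix (Fin m) (Fin n) DQ :=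
  of fun i j => inl (A i j) + inr (C i j)

theorem dualMatrix_fst_snd {m n : ℕ} (B : Matrix (Fin m) (Fin n) DQ) :
    dualMatrix (B.map fst) (B.map snd) = B := by
  ext1 i j
  exact inl_fst_add_inr_snd_eq _

theorem dualMatrix_one_zero (n : ℕ) :
    dualMatrix (1 : Matrix (Fin n) (Fin n) HQ) 0 = 1 := by
  ext1 i j
  by_cases h : i = j <;> simp [dualMatrix, Matrix.one_apply, h]

theorem dualMatrix_conjTranspose {m n : ℕ} (A C : Matrix (Fin m) (Fin n) HQ) :
    (dualMatrix A C)ᴴ = dualMatrix Aᴴ Cᴴ := by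
  ext1 i j
  change inl (star (fst (dualMatrix A C j i))) + inr (star (snd (dualMatrix A C j i))) = _
  simp [dualMatrix]

theorem dualMatrix_mul {l m n : ℕ} (A C : Matrix (Fin l) (Fin m) HQ)
    (A' C' : Matrix (Fin m) (Fin n) HQ) :
    dualMatrix A C * dualMatrix A' C' = dualMatrix (A * A') (A * C' + C * A') := by
  ext1 i j
  rw [Matrix.mul_apply]
  refine TrivSqZeroExt.ext ?_ ?_
  · rw [fst_sum]
    simp [dualMatrix, Matrix.mul_apply]
  · rw [snd_sum]
    simp [dualMatrix, Matrix.mul_apply, Finset.sum_add_distrib]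

theorem dualMatrix_unitary {n : ℕ} {P X : Matrix (Fin n) (Fin n) HQ} (hP : P ∈ unitarySet n)
    (hX : Xᴴ = -X) : (dualMatrix P (P * X))ᴴ * dualMatrix P (P * X) = 1 := by
  have hP : Pᴴ * P = 1 := hP
  rw [dualMatrix_conjTranspose, dualMatrix_mul, hP, conjTranspose_mul, ← Matrix.mul_assoc, hP,
    Matrix.mul_assoc, hP, hX, Matrix.one_mul, Matrix.mul_one, add_neg_cancel, dualMatrix_one_zero]

end DualMatrix

section Perturbation

/-- The two-sided Sylvester type equation behind the infinitesimal part of the decomposition. -/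
theorem exists_skew_solution {m n : ℕ} {σ δ : ℕ → ℝ} {d : ℕ → ℕ → HQ} (hσ : ∀ k, 0 ≤ σ k)
    (hre : ∀ k, (d k k).re = δ k)
    (hzero : ∀ i < m, ∀ j < n, σ i = 0 → σ j = 0 → d i j = if i = j then (δ i : HQ) else 0)
    (hskew : ∀ a b, a ≠ b → σ a = σ b → σ a ≠ 0 → d b a = -star (d a b)) :
    ∃ x y : ℕ → ℕ → HQ, (∀ i j, star (x j i) = -x i j) ∧ (∀ i j, star (y j i) = -y i j) ∧
      ∀ i < m, ∀ j < n,
        σ i • y i j + d i j = (if i = j then (δ i : HQ) else 0) + σ j • x i j := by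
  refine ⟨fun i j => (σ j ^ 2 - σ i ^ 2)⁻¹ • (σ j • d i j + σ i • star (d j i)),
    fun i j => if σ i = σ j then -(σ i)⁻¹ • (d i j - if i = j then (δ i : HQ) else 0)
      else (σ j ^ 2 - σ i ^ 2)⁻¹ • (σ i • d i j + σ j • star (d j i)), ?_, ?_, ?_⟩
  · intro i j
    have h : (σ i ^ 2 - σ j ^ 2)⁻¹ = -(σ j ^ 2 - σ i ^ 2)⁻¹ := by rw [← inv_neg, neg_sub]
    simp only [star_smul, star_add, star_star, star_neg, star_trivial, h, neg_smul]
    rw [add_comm]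
  · intro i j
    by_cases h : σ i = σ j
    · simp only [h, if_true]
      by_cases h0 : σ j = 0
      · simp [h0]
      · by_cases hij : i = j
        · subst hij
          have hd : star (d i i) = ((δ i : HQ) + δ i) - d i i := by
            rw [← hre i]
            ext <;> simp
          simp only [if_true, star_smul, star_sub, star_trivial, Quaternion.star_coe, hd, ← smul_neg]
          congr 1
          abel
        · simp only [hij, Ne.symm hij, if_false, star_smul, sub_zero, star_trivial,
            hskew i j hij h (h ▸ h0), star_neg, star_star, smul_neg]
    · have h' : (σ i ^ 2 - σ j ^ 2)⁻¹ = -(σ j ^ 2 - σ i ^ 2)⁻¹ := by rw [← inv_neg, neg_sub]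
      simp only [h, Ne.symm h, if_false, star_smul, star_add, star_star, star_neg, star_trivial, h',
        neg_smul]
      rw [add_comm]
  · intro i hi j hj
    by_cases h : σ i = σ j
    · by_cases h0 : σ j = 0
      · simp [h, h0, hzero i hi j hj (h.trans h0) h0]
      · simp only [h, if_true, sub_self, _root_.inv_zero, zero_smul, smul_zero, add_zero, neg_smul,
          smul_neg, smul_inv_smul₀ h0]
        abel
    · have hij : i ≠ j := fun hij => h (hij ▸ rfl)
      have hne : σ j ^ 2 - σ i ^ 2 ≠ 0 := fun h' =>
        h ((pow_left_inj₀ (hσ i) (hσ j) two_ne_zero).1 (sub_eq_zero.1 h').symm)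
      simp only [h, hij, if_false, zero_add]
      apply smul_right_injective HQ hne
      beta_reduce
      rw [smul_comm (σ i), smul_comm (σ j), smul_add, smul_inv_smul₀ hne, smul_inv_smul₀ hne]
      module

theorem mul_of_apply_of_natEntry {m n : ℕ} {M : Matrix (Fin m) (Fin n) HQ} {σ : ℕ → ℝ}
    (hM : ∀ i j, natEntry M i j = if i = j then (σ i : HQ) else 0) (y : ℕ → ℕ → HQ)
    (i : Fin m) (j : Fin n) :
    (M * (of fun i j => y i j : Matrix (Fin n) (Fin n) HQ)) i j = σ i • y i j := by
  have hM' (k : Fin n) : M i k = if (i : ℕ) = k then (σ i : HQ) else 0 :=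
    (natEntry_val M i k).symm.trans (hM _ _)
  simp only [Matrix.mul_apply, hM', of_apply]
  by_cases h : (i : ℕ) < n
  · rw [Fintype.sum_eq_single (⟨i, h⟩ : Fin n)]
    · simp [Quaternion.coe_mul_eq_smul]
    · intro k hk
      rw [if_neg fun h' => hk (Fin.ext h'.symm), zero_mul]
  · have h0 : (σ i : HQ) = 0 := by
      have := hM i i
      rw [natEntry_eq_zero M (Or.inr (not_lt.1 h)), if_pos rfl] at this
      exact this.symm
    rw [← Quaternion.coe_mul_eq_smul, h0, zero_mul]
    exact Finset.sum_eq_zero fun k _ => by simp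

theorem of_mul_apply_of_natEntry {m n : ℕ} {M : Matrix (Fin m) (Fin n) HQ} {σ : ℕ → ℝ}
    (hM : ∀ i j, natEntry M i j = if i = j then (σ i : HQ) else 0) (x : ℕ → ℕ → HQ)
    (i : Fin m) (j : Fin n) :
    ((of fun i j => x i j : Matrix (Fin m) (Fin m) HQ) * M) i j = σ j • x i j := by
  have hM' (k : Fin m) : M k j = if (j : ℕ) = k then (σ j : HQ) else 0 := by
    rw [(natEntry_val M k j).symm.trans (hM _ _)]
    by_cases h : (k : ℕ) = j
    · rw [h]
    · rw [if_neg h, if_neg (Ne.symm h)]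
  simp only [Matrix.mul_apply, hM', of_apply]
  by_cases h : (j : ℕ) < m
  · rw [Fintype.sum_eq_single (⟨j, h⟩ : Fin m)]
    · simp [Quaternion.mul_coe_eq_smul]
    · intro k hk
      rw [if_neg fun h' => hk (Fin.ext h'.symm), mul_zero]
  · have h0 : (σ j : HQ) = 0 := by
      have := hM j j
      rw [natEntry_eq_zero M (Or.inl (not_lt.1 h)), if_pos rfl] at this
      exact this.symm
    rw [← Quaternion.mul_coe_eq_smul, h0, mul_zero]
    exact Finset.sum_eq_zero fun k _ => by simp

end Perturbation

theorem DQ.le_zero_left_iff (a b : ℝ) :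
    DQ.le 0 (inl (a : HQ) + inr (b : HQ)) ↔ 0 < a ∨ 0 = a ∧ 0 ≤ b := by
  have h0 : (0 : DQ) = inl ((0 : ℝ) : HQ) + inr ((0 : ℝ) : HQ) := by simp
  rw [h0]
  simp only [DQ.le, fst_add, fst_inl, fst_inr, snd_add, snd_inl, snd_inr, add_zero, zero_add,
    Quaternion.re_coe]

theorem DQ.lt_zero_left_iff (a b : ℝ) :
    DQ.lt 0 (inl (a : HQ) + inr (b : HQ)) ↔ 0 < a ∨ 0 = a ∧ 0 < b := by
  have h0 : (0 : DQ) = inl ((0 : ℝ) : HQ) + inr ((0 : ℝ) : HQ) := by simp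
  rw [h0]
  simp only [DQ.lt, fst_add, fst_inl, fst_inr, snd_add, snd_inl, snd_inr, add_zero, zero_add,
    Quaternion.re_coe]

theorem Fin.exists_lt_iff_of_antitone {N : ℕ} {p : Fin N → Prop}
    (hp : ∀ k l, k ≤ l → p l → p k) : ∃ t ≤ N, ∀ k : Fin N, (k : ℕ) < t ↔ p k := by
  classical
  have hex : ∃ t, ∀ h : t < N, ¬ p ⟨t, h⟩ := ⟨N, fun h => absurd h (lt_irrefl N)⟩
  refine ⟨Nat.find hex, Nat.find_min' hex fun h => absurd h (lt_irrefl N), fun k => ?_⟩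
  refine ⟨fun h => ?_, fun h => ?_⟩
  · have := Nat.find_min hex h
    push Not at this
    exact this.2
  · by_contra! hk
    exact Nat.find_spec hex (hk.trans_lt k.2) (hp _ _ hk h)

/-- Singular value decomposition of a dual quaternion matrix: there are unitary `V`, `U` with
`V* B U` having zero off-diagonal entries and decreasingly ordered nonnegative dual number
diagonal entries `μ₁ ≥ … ≥ μ_{min(m,n)}`; for some `t`, `μ₁, …, μ_t` are positive and the
rest are zero, and among the positive ones the appreciable ones (positive standard part)
come first (`r` of them), followed by the positive infinitesimal ones. -/
theorem dual_quaternion_svd {m n : ℕ} (B : Matrix (Fin m) (Fin n) DQ) :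
    ∃ (V : Matrix (Fin m) (Fin m) DQ) (U : Matrix (Fin n) (Fin n) DQ)
      (mu : Fin (min m n) → DQ) (t r : ℕ),
      Vᴴ * V = 1 ∧ Uᴴ * U = 1 ∧
      (∀ (i : Fin m) (j : Fin n), (i : ℕ) ≠ (j : ℕ) → (Vᴴ * B * U) i j = 0) ∧
      (∀ k : Fin (min m n),
        (Vᴴ * B * U) ⟨(k : ℕ), lt_of_lt_of_le k.isLt (Nat.min_le_left m n)⟩
          ⟨(k : ℕ), lt_of_lt_of_le k.isLt (Nat.min_le_right m n)⟩ = mu k) ∧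
      (∀ k, DQ.IsDualNum (mu k) ∧ DQ.le 0 (mu k)) ∧
      (∀ k l : Fin (min m n), k ≤ l → DQ.le (mu l) (mu k)) ∧
      r ≤ t ∧ t ≤ min m n ∧
      (∀ k : Fin (min m n), (k : ℕ) < t → DQ.lt 0 (mu k)) ∧
      (∀ k : Fin (min m n), t ≤ (k : ℕ) → mu k = 0) ∧
      (∀ k : Fin (min m n), (k : ℕ) < r → fst (mu k) ≠ 0) ∧
      (∀ k : Fin (min m n), r ≤ (k : ℕ) → (k : ℕ) < t → fst (mu k) = 0) := by
  obtain ⟨P, hP, Q, hQ, σ, δ, hM, hre, hσ, hδ, hord, hzero, hskew⟩ :=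
    exists_normal_form (B.map fst) (B.map snd)
  obtain ⟨x, y, hx, hy, hxy⟩ := exists_skew_solution hσ hre hzero hskew
  set M := Pᴴ * B.map fst * Q
  set D := Pᴴ * B.map snd * Q
  set X : Matrix (Fin m) (Fin m) HQ := of fun i j => x i j with hXdef
  set Y : Matrix (Fin n) (Fin n) HQ := of fun i j => y i j with hYdef
  have hX : Xᴴ = -X := by
    ext1 i j
    exact hx i j
  have hY : Yᴴ = -Y := by
    ext1 i j
    exact hy i j
  have hprod : (dualMatrix P (P * X))ᴴ * B * dualMatrix Q (Q * Y) =
      dualMatrix M (M * Y + D - X * M) := by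
    conv_lhs => rw [← dualMatrix_fst_snd B]
    rw [dualMatrix_conjTranspose, dualMatrix_mul, dualMatrix_mul, conjTranspose_mul, hX]
    congr 1
    simp only [M, D, Matrix.add_mul, Matrix.mul_assoc, Matrix.neg_mul]
    abel
  have hentry (i : Fin m) (j : Fin n) :
      ((dualMatrix P (P * X))ᴴ * B * dualMatrix Q (Q * Y)) i j =
        if (i : ℕ) = j then inl (σ i : HQ) + inr (δ i : HQ) else 0 := by
    have h1 : M i j = if (i : ℕ) = j then (σ i : HQ) else 0 :=
      (natEntry_val M i j).symm.trans (hM _ _)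
    have h2 : (M * Y + D - X * M) i j = if (i : ℕ) = j then (δ i : HQ) else 0 := by
      rw [Matrix.sub_apply, Matrix.add_apply, mul_of_apply_of_natEntry hM,
        of_mul_apply_of_natEntry hM, ← natEntry_val D, hxy i i.2 j j.2, add_sub_cancel_right]
    rw [hprod, dualMatrix, of_apply, h1, h2]
    split_ifs <;> simp
  have hm (k : Fin (min m n)) : (k : ℕ) < m := k.2.trans_le (min_le_left _ _)
  have hn (k : Fin (min m n)) : (k : ℕ) < n := k.2.trans_le (min_le_right _ _)
  have hordF (k l : Fin (min m n)) (hkl : k ≤ l) : σ l ≤ σ k ∧ (σ k = σ l → δ l ≤ δ k) := by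
    rcases hkl.eq_or_lt with rfl | h
    · exact ⟨le_rfl, fun _ => le_rfl⟩
    · exact hord k l h (hm l) (hn l)
  obtain ⟨t, htN, ht⟩ := Fin.exists_lt_iff_of_antitone
    (p := fun k : Fin (min m n) => 0 < σ k ∨ 0 < δ k) (by
      intro k l hkl h
      obtain ⟨h1, h2⟩ := hordF k l hkl
      rcases (hσ k).eq_or_lt with h0 | h0
      · have hl : σ l = 0 := le_antisymm (h1.trans h0.ge) (hσ l)
        exact Or.inr ((h.resolve_left hl.not_gt).trans_le (h2 (h0.symm.trans hl.symm)))
      · exact Or.inl h0)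
  obtain ⟨r, hrN, hr⟩ := Fin.exists_lt_iff_of_antitone
    (p := fun k : Fin (min m n) => 0 < σ k) fun k l hkl h => h.trans_le (hordF k l hkl).1
  refine ⟨dualMatrix P (P * X), dualMatrix Q (Q * Y),
    fun k => inl (σ k : HQ) + inr (δ k : HQ), t, r, dualMatrix_unitary hP hX,
    dualMatrix_unitary hQ hY, fun i j hij => by rw [hentry, if_neg hij],
    fun k => by rw [hentry, if_pos rfl], fun k => ⟨⟨_, _, rfl⟩, ?_⟩, fun k l hkl => ?_, ?_, htN,
    fun k hk => ?_, fun k hk => ?_, fun k hk => ?_, fun k hk _ => ?_⟩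
  · rw [DQ.le_zero_left_iff]
    exact (hσ k).lt_or_eq.imp id fun h0 => ⟨h0, hδ k h0.symm⟩
  · obtain ⟨h1, h2⟩ := hordF k l hkl
    rcases h1.eq_or_lt with h0 | h0
    · right
      simpa [h0] using h2 h0.symm
    · left
      simpa using h0
  · by_contra! h
    exact (lt_irrefl t) ((ht ⟨t, h.trans_le hrN⟩).2 (Or.inl ((hr ⟨t, h.trans_le hrN⟩).1 h)))
  · rw [DQ.lt_zero_left_iff]
    exact (hσ k).lt_or_eq.imp id fun h0 => ⟨h0, ((ht k).1 hk).resolve_left h0.not_lt⟩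
  · have h := mt (ht k).2 (not_lt.2 hk)
    push Not at h
    have h0 : σ k = 0 := le_antisymm h.1 (hσ k)
    have h1 : δ k = 0 := le_antisymm h.2 (hδ k h0)
    simp [h0, h1]
  · simpa using coe_ne_zero ((hr k).1 hk).ne'
  · have h0 : σ k = 0 := le_antisymm (not_lt.1 (mt (hr k).2 (not_lt.2 hk))) (hσ k)
    simp [h0]
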